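/- If Q is a correlated equilibrium of the MRF-induced game, then for every player i ∈ V and every distribution Q'_i on A_i, the cross entropy of Q with respect to P is at most that of the product Q'_i Q_{-i}: H(Q, P) ≤ H(Q'_i Q_{-i}, P). Equivalently, H(Q, P) ≤ min_i min_{Q'_i} H(Q'_i Q_{-i}, P). -/

import Mathlib

open Finset

/-- If `Q` is a correlated equilibrium of the MRF-induced game,
then for every player `i` and every distribution `Q'i` on `A i`, the cross entropy
of `Q` with respect to `P` is at most that of the product `Q'i ⊗ Q₋ᵢ`. -/
theorem ce_cross_entropy_bound
    {V : Type*} [Fintype V] [DecidableEq V]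
    {A : V → Type*} [∀ v, Fintype (A v)] [∀ v, DecidableEq (A v)] [∀ v, Nonempty (A v)]
    (𝒞 : Finset (Finset V))
    (φ : (C : Finset V) → ((j : {v // v ∈ C}) → A j.val) → ℝ)
    (Ψ : (∀ v, A v) → ℝ)
    (hΨ : ∀ x, Ψ x = ∑ C ∈ 𝒞, φ C (fun j => x j.val))
    (M : V → (∀ v, A v) → ℝ)
    (hM : ∀ i x, M i x = ∑ C ∈ 𝒞.filter (fun C => i ∈ C), φ C (fun j => x j.val))
    (Z : ℝ) (hZ : Z = ∑ x : ∀ v, A v, Real.exp (Ψ x))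
    (P : (∀ v, A v) → ℝ) (hP : ∀ x, P x = Real.exp (Ψ x) / Z)
    (Q : (∀ v, A v) → ℝ)
    (hQ0 : ∀ x, 0 ≤ Q x) (hQ1 : ∑ x : ∀ v, A v, Q x = 1)
    (hCE : ∀ (i : V) (xi x'i : A i),
      ∑ x ∈ Finset.univ.filter (fun x : ∀ v, A v => x i = xi),
          Q x * M i (Function.update x i x'i) ≤
        ∑ x ∈ Finset.univ.filter (fun x : ∀ v, A v => x i = xi), Q x * M i x) :
    ∀ (i : V) (Q'i : A i → ℝ), (∀ a, 0 ≤ Q'i a) → (∑ a : A i, Q'i a = 1) →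
      -(∑ x : ∀ v, A v, Q x * Real.log (P x)) ≤
        -(∑ x : ∀ v, A v,
            (Q'i (x i) * ∑ a : A i, Q (Function.update x i a)) * Real.log (P x)) := by
  intro i q hq0 hq1
  have hZpos : 0 < Z := by
    rw [hZ]
    exact Finset.sum_pos (fun x _ => Real.exp_pos _) Finset.univ_nonempty
  have hL : ∀ x, Real.log (P x) = Ψ x - Real.log Z := by
    intro x
    rw [hP, Real.log_div (Real.exp_pos _).ne' hZpos.ne', Real.log_exp]
  -- unilateral deviations change `Ψ` exactly as they change `M i`
  have hdiff : ∀ x b, Ψ (Function.update x i b) - Ψ x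
      = M i (Function.update x i b) - M i x := by
    intro x b
    rw [hΨ, hΨ, hM, hM, ← Finset.sum_sub_distrib, ← Finset.sum_sub_distrib,
      Finset.sum_filter]
    refine Finset.sum_congr rfl fun C _ => ?_
    split_ifs with h
    · rfl
    · have : (fun j : {v // v ∈ C} => Function.update x i b j.val) =
          fun j : {v // v ∈ C} => x j.val := by
        funext j
        exact Function.update_of_ne (fun hj : j.val = i => h (hj ▸ j.2)) _ _
      rw [this, sub_self]
  have hMle : ∀ b, ∑ x, Q x * M i (Function.update x i b) ≤ ∑ x, Q x * M i x := by
    intro b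
    rw [← Finset.sum_fiberwise Finset.univ (fun x : ∀ v, A v => x i)
        (fun x => Q x * M i (Function.update x i b)),
      ← Finset.sum_fiberwise Finset.univ (fun x : ∀ v, A v => x i) (fun x => Q x * M i x)]
    exact Finset.sum_le_sum fun a _ => hCE i a b
  have hle : ∀ b, ∑ x, Q x * Real.log (P (Function.update x i b))
      ≤ ∑ x, Q x * Real.log (P x) := by
    intro b
    have h1 := hMle b
    rw [← sub_nonpos, ← Finset.sum_sub_distrib] at h1 ⊢
    refine le_of_eq_of_le (Finset.sum_congr rfl fun x _ => ?_) h1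
    rw [hL, hL]
    linear_combination Q x * hdiff x b
  have hre : ∑ x : ∀ v, A v,
        (q (x i) * ∑ a : A i, Q (Function.update x i a)) * Real.log (P x)
      = ∑ b, q b * ∑ x, Q x * Real.log (P (Function.update x i b)) := by
    simp_rw [Finset.mul_sum, Finset.sum_mul]
    rw [Finset.sum_comm (s := (Finset.univ : Finset (A i)))]
    rw [← Fintype.sum_prod_type', ← Fintype.sum_prod_type']
    have hinv : Function.Involutive
        (fun p : (∀ v, A v) × A i => (Function.update p.1 i p.2, p.1 i)) := by
      rintro ⟨x, a⟩
      simp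
    refine Fintype.sum_equiv hinv.toPerm _ _ ?_
    rintro ⟨x, a⟩
    simp [Function.Involutive.toPerm]
    ring
  rw [neg_le_neg_iff, hre]
  calc _ ≤ ∑ b, q b * ∑ x, Q x * Real.log (P x) :=
        Finset.sum_le_sum fun b _ => mul_le_mul_of_nonneg_left (hle b) (hq0 b)
    _ = _ := by rw [← Finset.sum_mul, hq1, one_mul]
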